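/- arXiv:2310.06986 — 2 statements merged into one kernel-verified Lean document; each statement's English description precedes it below -/
import Mathlib

section
/- Let i, j, k, l ≥ 2 be integers. Then ∫_{(−1,1)²} L̂_i(x) L̂_j(y) · P^{(1,1)}_{k−2}(x) P^{(1,1)}_{l−2}(y) dx dy equals 16/( i (2i−1) j (2j−1) ) if (i,j) = (k,l), and equals 0 otherwise. In other words, the interior H¹ shape functions L̂_i(x)L̂_j(y) on the square and the tensor products of Jacobi polynomials P^{(1,1)}_{k−2}(x)P^{(1,1)}_{l−2}(y) form a biorthogonal system in L²((−1,1)²). -/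
open MeasureTheory

/-- Jacobi polynomial `P_n^{(a,b)}` via the Rodrigues formula (on `(-1,1)`). -/
noncomputable def jacobiP (n a b : ℕ) (x : ℝ) : ℝ :=
  (1 / ((2:ℝ)^n * (Nat.factorial n : ℝ) * (1 - x)^a * (1 + x)^b)) *
    iteratedDeriv n (fun t : ℝ => (1 - t)^a * (1 + t)^b * (t^2 - 1)^n) x

/-- Legendre polynomial `L_n = P_n^{(0,0)}`. -/
noncomputable def legendreP (n : ℕ) (x : ℝ) : ℝ := jacobiP n 0 0 x

/-- Integrated Jacobi polynomial `P̂_n^a(x) = ∫_{-1}^x P_{n-1}^{(a,0)}(t) dt`. -/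
noncomputable def intJacobiP (n a : ℕ) (x : ℝ) : ℝ :=
  ∫ t in (-1:ℝ)..x, jacobiP (n - 1) a 0 t

/-- Integrated Legendre polynomial `L̂_n`. -/
noncomputable def intLegendreP (n : ℕ) (x : ℝ) : ℝ := intJacobiP n 0 x

/-- The open reference square `(-1,1)²`. -/
def Sq : Set (ℝ × ℝ) := Set.Ioo (-1:ℝ) 1 ×ˢ Set.Ioo (-1:ℝ) 1

open Polynomial in
/-- The polynomial `X² - 1`. -/
noncomputable def Wp : ℝ[X] := X ^ 2 - 1

open Polynomial in
/-- Derivatives of powers of `Wp`. -/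
noncomputable def Ap (n k : ℕ) : ℝ[X] := derivative^[k] (Wp ^ n)

open Polynomial in
theorem iteratedDeriv_poly (n : ℕ) (p : ℝ[X]) :
    iteratedDeriv n (fun t => p.eval t) = fun t => (derivative^[n] p).eval t := by
  induction n with
  | zero => simp
  | succ n ih =>
    rw [iteratedDeriv_succ, ih, Function.iterate_succ_apply']
    ext x
    simp

open Polynomial in
theorem Ap_succ (n k : ℕ) : Ap n (k+1) = derivative (Ap n k) := by
  simp [Ap, Function.iterate_succ_apply']

open Polynomial in
theorem Ap_eval_zero (n k : ℕ) (h : k < n) (x : ℝ) (hx : x ^ 2 = 1) : (Ap n k).eval x = 0 := by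
  have h1 : Wp ∣ Ap n k := by
    refine dvd_trans (dvd_pow_self _ (by omega : n - k ≠ 0)) ?_
    exact pow_sub_dvd_iterate_derivative_pow Wp n k
  obtain ⟨q, hq⟩ := h1
  rw [hq]; simp [Wp, hx]

open Polynomial in
theorem Ap_ode (m : ℕ) : Wp * Ap (m+1) (m+2) = C (((m:ℝ)+1) * (m+2)) * Ap (m+1) m := by
  have c2 : (C (2:ℝ)) = 2 := map_ofNat C 2
  have h : derivative (Wp ^ (m+1)) * X * X - derivative (Wp^(m+1)) =
      C (2 * ((m:ℝ)+1)) * (Wp ^ (m+1) * X) := by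
    rw [derivative_pow_succ]
    simp [Wp, c2]
    ring
  have h2 := congrArg (derivative^[m+1]) h
  rw [iterate_derivative_sub, iterate_derivative_mul_X, iterate_derivative_C_mul,
    iterate_derivative_mul_X, iterate_derivative_mul_X, Nat.add_sub_cancel,
    iterate_derivative_mul_X] at h2
  simp only [← Function.iterate_succ_apply] at h2
  have e0 : derivative^[m] (Wp^(m+1)) = Ap (m+1) m := rfl
  have e1 : derivative^[m+1] (Wp^(m+1)) = Ap (m+1) (m+1) := rfl
  have e2 : derivative^[m+1+1] (Wp^(m+1)) = Ap (m+1) (m+2) := rfl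
  simp only [Nat.succ_eq_add_one, e0, e1, e2] at h2
  cases m with
  | zero =>
    simp [c2] at h2 ⊢
    have e3 : Ap 1 0 = Wp := by simp [Ap]
    rw [e3]
    unfold Wp at *
    linear_combination h2
  | succ m =>
    simp only [Nat.add_sub_cancel, e0] at h2
    unfold Wp
    simp [c2] at h2 ⊢
    linear_combination h2

open Polynomial in
theorem parts (p q : ℝ[X]) (h1 : q.eval 1 = 0) (h2 : q.eval (-1) = 0) :
    ∫ x in (-1:ℝ)..1, p.eval x * (derivative q).eval x =
      - ∫ x in (-1:ℝ)..1, (derivative p).eval x * q.eval x := by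
  rw [intervalIntegral.integral_mul_deriv_eq_deriv_mul (fun x _ => p.hasDerivAt x)
    (fun x _ => q.hasDerivAt x) ((derivative p).continuous.intervalIntegrable _ _)
    ((derivative q).continuous.intervalIntegrable _ _), h1, h2]
  simp

open Polynomial in
theorem parts_iter (n r : ℕ) (h : r ≤ n) (p : ℝ[X]) :
    ∫ x in (-1:ℝ)..1, p.eval x * (Ap n r).eval x =
      (-1)^r * ∫ x in (-1:ℝ)..1, (derivative^[r] p).eval x * (Wp ^ n).eval x := by
  induction r generalizing p with
  | zero => simp [Ap]
  | succ r ih =>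
    rw [Ap_succ, parts _ _ (Ap_eval_zero n r (by omega) _ (by norm_num))
      (Ap_eval_zero n r (by omega) _ (by norm_num)), ih (by omega), Function.iterate_succ_apply]
    ring

open Polynomial in
theorem natDegree_Wp_pow (n : ℕ) : (Wp ^ n).natDegree = 2 * n := by
  have h : Wp = X ^ 2 - C 1 := by simp [Wp]
  rw [natDegree_pow, h, natDegree_X_pow_sub_C, mul_comm]

open Polynomial in
theorem monic_Wp_pow (n : ℕ) : (Wp ^ n).Monic := by
  have h : Wp = X ^ 2 - C 1 := by simp [Wp]
  rw [h]; exact (monic_X_pow_sub_C _ (by norm_num)).pow n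

open Polynomial in
theorem Ap_top (n : ℕ) : derivative^[n] (Ap n n) = C ((Nat.factorial (2*n) : ℝ)) := by
  have e : derivative^[n] (Ap n n) = derivative^[2*n] (Wp^n) := by
    rw [Ap, ← Function.iterate_add_apply, two_mul]
  rw [e]
  have hd := natDegree_iterate_derivative (Wp^n) (2*n)
  rw [natDegree_Wp_pow, Nat.sub_self] at hd
  rw [eq_C_of_natDegree_le_zero hd, coeff_iterate_derivative]
  have := (monic_Wp_pow n).coeff_natDegree
  rw [natDegree_Wp_pow] at this
  rw [zero_add, this, Nat.descFactorial_self]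
  simp

open Polynomial in
theorem Ap_small (m n : ℕ) (h : m < n) : derivative^[n] (Ap m m) = 0 := by
  rw [Ap, ← Function.iterate_add_apply]
  apply iterate_derivative_eq_zero
  rw [natDegree_Wp_pow]; omega

open Polynomial in
theorem int_W (n : ℕ) : (Nat.factorial (2*n+1) : ℝ) * ∫ x in (-1:ℝ)..1, (Wp ^ n).eval x =
    (-1)^n * 2^(2*n+1) * (Nat.factorial n : ℝ)^2 := by
  induction n with
  | zero => simp; norm_num
  | succ n ih =>
    have hD : ∫ x in (-1:ℝ)..1, (derivative (X * Wp^(n+1))).eval x = 0 := by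
      rw [intervalIntegral.integral_eq_sub_of_hasDerivAt (fun x _ => (X * Wp^(n+1)).hasDerivAt x)
        ((derivative (X * Wp^(n+1))).continuous.intervalIntegrable _ _)]
      simp [Wp]
    have hE : derivative (X * Wp^(n+1)) = C (2*(n:ℝ)+3) * Wp^(n+1) + C (2*(n:ℝ)+2) * Wp^n := by
      rw [derivative_mul, derivative_pow_succ]
      simp [Wp, pow_succ, show (C (2:ℝ)) = 2 from map_ofNat C 2, show (C (3:ℝ)) = 3 from map_ofNat C 3]
      ring
    rw [hE] at hD
    simp only [eval_add, eval_mul, eval_C] at hD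
    rw [intervalIntegral.integral_add
      (((Wp^(n+1)).continuous.const_mul _ |>.intervalIntegrable _ _))
      (((Wp^n).continuous.const_mul _ |>.intervalIntegrable _ _)),
      intervalIntegral.integral_const_mul, intervalIntegral.integral_const_mul] at hD
    have e : 2 * (n+1) + 1 = (2*n+1) + 1 + 1 := by ring
    rw [e, Nat.factorial_succ, Nat.factorial_succ, Nat.factorial_succ n]
    push_cast
    generalize (∫ x in (-1:ℝ)..1, (Wp ^ (n+1)).eval x) = I1 at *
    generalize (∫ x in (-1:ℝ)..1, (Wp ^ n).eval x) = I0 at *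
    linear_combination (2*(n:ℝ)+2) * (Nat.factorial (2*n+1) : ℝ) * hD - (2*(n:ℝ)+2)^2 * ih

open Polynomial in
theorem orth_lt (m n : ℕ) (h : m < n) :
    ∫ x in (-1:ℝ)..1, (Ap m m).eval x * (Ap n n).eval x = 0 := by
  rw [parts_iter n n le_rfl, Ap_small m n h]
  simp

open Polynomial in
theorem orth (m n : ℕ) :
    ∫ x in (-1:ℝ)..1, (Ap m m).eval x * (Ap n n).eval x =
      if m = n then 2^(2*n+1) * (Nat.factorial n : ℝ)^2 / (2*n+1) else 0 := by
  split_ifs with h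
  · subst h
    rw [parts_iter m m le_rfl, Ap_top]
    simp only [eval_C]
    rw [intervalIntegral.integral_const_mul]
    have := int_W m
    rw [Nat.factorial_succ] at this
    push_cast at this
    have h1 : (2*(m:ℝ)+1) ≠ 0 := by positivity
    have h2 : ((-1:ℝ)^m) * (-1)^m = 1 := by rw [← mul_pow]; simp
    rw [eq_div_iff h1]
    linear_combination (-1)^m * this + 2^(2*m+1) * (Nat.factorial m : ℝ)^2 * h2
  · rcases lt_or_gt_of_ne h with h | h
    · exact orth_lt m n h
    · simp_rw [mul_comm (eval _ (Ap m m))]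
      exact orth_lt n m h

open Polynomial in
theorem leg_eq (m : ℕ) (x : ℝ) :
    jacobiP m 0 0 x = (1 / (2^m * (Nat.factorial m : ℝ))) * (Ap m m).eval x := by
  have := congrFun (iteratedDeriv_poly m (Wp^m)) x
  simp only [Wp, eval_pow, eval_sub, eval_X, eval_one] at this
  simp [jacobiP, this, Ap, Wp]

open Polynomial in
theorem intleg_eq (m : ℕ) (x : ℝ) :
    intLegendreP (m+2) x =
      (1 / (2^(m+1) * (Nat.factorial (m+1) : ℝ))) * (Ap (m+1) m).eval x := by
  unfold intLegendreP intJacobiP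
  simp only [show m + 2 - 1 = m + 1 from rfl, leg_eq]
  rw [intervalIntegral.integral_const_mul, Ap_succ,
    intervalIntegral.integral_eq_sub_of_hasDerivAt (fun x _ => (Ap (m+1) m).hasDerivAt x)
        ((derivative (Ap (m+1) m)).continuous.intervalIntegrable _ _),
    Ap_eval_zero (m+1) m (by omega) (-1) (by norm_num), sub_zero]

open Polynomial in
theorem jac_eq (n : ℕ) (x : ℝ) (hx : x ∈ Set.Ioo (-1:ℝ) 1) :
    jacobiP n 1 1 x =
      (1 / (2^n * (Nat.factorial n : ℝ) * ((n+1)*(n+2)))) * (Ap (n+1) (n+2)).eval x := by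
  have hf : (fun t : ℝ => (1 - t)^1 * (1 + t)^1 * (t^2 - 1)^n) =
      fun t => (C (-1) * Wp^(n+1)).eval t := by
    ext t; simp [Wp]; ring
  have ho := congrArg (eval x) (Ap_ode n)
  unfold jacobiP
  rw [hf, iteratedDeriv_poly, iterate_derivative_C_mul]
  have h1 : 1 - x ≠ 0 := by have := hx.2; intro h; linarith
  have h2 : 1 + x ≠ 0 := by have := hx.1; intro h; linarith
  have h3 : ((n:ℝ)+1) ≠ 0 := by positivity
  have h4 : ((n:ℝ)+2) ≠ 0 := by positivity
  have h5 : (Nat.factorial n : ℝ) ≠ 0 := by positivity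
  change _ * eval x (C (-1) * Ap (n+1) n) = _
  simp only [eval_mul, eval_C, Wp, eval_sub, eval_pow, eval_X, eval_one] at ho ⊢
  field_simp
  linear_combination ho

open Polynomial in
theorem one_dim (i k : ℕ) (hi : 2 ≤ i) (hk : 2 ≤ k) :
    ∫ x in Set.Ioo (-1:ℝ) 1, intLegendreP i x * jacobiP (k-2) 1 1 x =
      if i = k then -4 / ((i:ℝ) * (2*(i:ℝ) - 1)) else 0 := by
  obtain ⟨m, rfl⟩ := Nat.exists_eq_add_of_le' hi
  obtain ⟨n, rfl⟩ := Nat.exists_eq_add_of_le' hk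
  rw [Nat.add_sub_cancel]
  have e : ∫ x in Set.Ioo (-1:ℝ) 1, intLegendreP (m+2) x * jacobiP n 1 1 x =
      ∫ x in Set.Ioo (-1:ℝ) 1, ((1 / (2^(m+1) * (Nat.factorial (m+1) : ℝ))) *
        (1 / (2^n * (Nat.factorial n : ℝ) * ((n+1)*(n+2))))) *
        ((Ap (m+1) m).eval x * (Ap (n+1) (n+2)).eval x) := by
    apply setIntegral_congr_fun measurableSet_Ioo
    intro x hx
    simp only [intleg_eq, jac_eq n x hx]
    ring
  rw [e, ← integral_Ioc_eq_integral_Ioo, ← intervalIntegral.integral_of_le (by norm_num),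
    intervalIntegral.integral_const_mul]
  have p := parts (Ap (n+1) (n+1)) (Ap (m+1) m) (Ap_eval_zero _ _ (by omega) _ (by norm_num))
    (Ap_eval_zero _ _ (by omega) _ (by norm_num))
  rw [← Ap_succ, ← Ap_succ, orth] at p
  simp_rw [mul_comm (eval _ (Ap (m+1) m))]
  rw [← neg_eq_iff_eq_neg.mpr p]
  by_cases h : m = n
  · subst h
    simp only [if_true]
    rw [Nat.factorial_succ]
    push_cast
    have h3 : ((m:ℝ)+1) ≠ 0 := by positivity
    have h4 : ((m:ℝ)+2) ≠ 0 := by positivity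
    have h6 : (2*((m:ℝ)+2) - 1) ≠ 0 := by
      have : (0:ℝ) ≤ m := Nat.cast_nonneg m
      intro h; linarith
    have h7 : (2*((m:ℝ)+1) + 1) ≠ 0 := by positivity
    have h5 : (Nat.factorial m : ℝ) ≠ 0 := by positivity
    field_simp
    ring
  · rw [if_neg (by omega), if_neg (by omega)]; simp

/-- Biorthogonality of the interior `H¹` shape functions on the square and the
tensor products of Jacobi polynomials. -/
theorem square_H1_biorthogonal (i j k l : ℕ) (hi : 2 ≤ i) (hj : 2 ≤ j)
    (hk : 2 ≤ k) (hl : 2 ≤ l) :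
    ∫ p in Sq, (intLegendreP i p.1 * intLegendreP j p.2) *
        (jacobiP (k-2) 1 1 p.1 * jacobiP (l-2) 1 1 p.2) =
      if (i, j) = (k, l) then
        16 / ((i:ℝ) * (2*(i:ℝ) - 1) * (j:ℝ) * (2*(j:ℝ) - 1))
      else 0 := by
  have e : ∀ p : ℝ × ℝ, (intLegendreP i p.1 * intLegendreP j p.2) *
        (jacobiP (k-2) 1 1 p.1 * jacobiP (l-2) 1 1 p.2) =
      (fun x => intLegendreP i x * jacobiP (k-2) 1 1 x) p.1 *
      (fun x => intLegendreP j x * jacobiP (l-2) 1 1 x) p.2 := fun p => by ring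
  simp_rw [e]
  rw [Sq, Measure.volume_eq_prod]
  refine (setIntegral_prod_mul (fun x => intLegendreP i x * jacobiP (k-2) 1 1 x)
    (fun x => intLegendreP j x * jacobiP (l-2) 1 1 x) _ _).trans ?_
  rw [one_dim i k hi hk, one_dim j l hj hl]
  by_cases h1 : i = k <;> by_cases h2 : j = l
  · simp only [h1, h2, if_true]
    rw [div_mul_div_comm]
    norm_num [mul_assoc]
  all_goals simp [h1, h2]
end

section
/- For integers i, j ≥ 2 set v^I_{ij} = ṽ^I_{ij} + ṽ^II_{ij} and v^II_{ij} = ṽ^I_{ij} − ṽ^II_{ij} (so that v^I_{ij} = ∇(L̂_i(x)L̂_j(y))), and for i ≥ 2 set v^III_i(x,y) = (L̂_i(y), 0) and w^III_i(x,y) = (0, −L̂_i(x)). With α_{ij} = i(2i−1)(2j−1)/8, define for k, l ≥ 2: b^I_{kl} = −½( α_{lk} b̃^I_{kl} + α_{kl} b̃^II_{kl} ), b^II_{kl} = −½( α_{lk} b̃^I_{kl} − α_{kl} b̃^II_{kl} ), b^III_l = −( l(2l−1)/8 ) b̃^I_{1l}, and c^III_l = ( l(2l−1)/8 ) b̃^II_{l1}.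 Then the two systems {v^I_{ij}, v^II_{ij}, v^III_i, w^III_i} and {b^I_{kl}, b^II_{kl}, b^III_l, c^III_l} are biorthonormal in L²(□)²: for any member of the first system and any member of the second, ∫_□ (primal)·(dual) dx dy equals 1 if they have the same type and the same index/indices, and equals 0 otherwise. -/
open MeasureTheory

/-- Euclidean dot product in `ℝ²`. -/
def dot2 (p q : ℝ × ℝ) : ℝ := p.1 * q.1 + p.2 * q.2

/-- Auxiliary `H(curl)` interior field of type I on the square. -/
noncomputable def vtSqI (i j : ℕ) (p : ℝ × ℝ) : ℝ × ℝ :=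
  (legendreP (i-1) p.1 * intLegendreP j p.2, 0)

/-- Auxiliary `H(curl)` interior field of type II on the square. -/
noncomputable def vtSqII (i j : ℕ) (p : ℝ × ℝ) : ℝ × ℝ :=
  (0, intLegendreP i p.1 * legendreP (j-1) p.2)

/-- Dual candidate of type I on the square. -/
noncomputable def btSqI (k l : ℕ) (p : ℝ × ℝ) : ℝ × ℝ :=
  (legendreP (k-1) p.1 * jacobiP (l-2) 1 1 p.2, 0)

/-- Dual candidate of type II on the square. -/
noncomputable def btSqII (k l : ℕ) (p : ℝ × ℝ) : ℝ × ℝ :=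
  (0, jacobiP (k-2) 1 1 p.1 * legendreP (l-1) p.2)

/-- `H(curl)` interior shape function of type I on the square,
`v^I_{ij} = ṽ^I_{ij} + ṽ^II_{ij} = ∇(L̂_i(x) L̂_j(y))`. -/
noncomputable def vSqI (i j : ℕ) (p : ℝ × ℝ) : ℝ × ℝ := vtSqI i j p + vtSqII i j p

/-- `H(curl)` interior shape function of type II on the square. -/
noncomputable def vSqII (i j : ℕ) (p : ℝ × ℝ) : ℝ × ℝ := vtSqI i j p - vtSqII i j p

/-- `H(curl)` shape function of type III on the square (first family). -/
noncomputable def vSqIII (i : ℕ) (p : ℝ × ℝ) : ℝ × ℝ := (intLegendreP i p.2, 0)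

/-- `H(curl)` shape function of type III on the square (second family). -/
noncomputable def wSqIII (i : ℕ) (p : ℝ × ℝ) : ℝ × ℝ := (0, -intLegendreP i p.1)

/-- The coefficients `α_{ij} = i(2i-1)(2j-1)/8`. -/
noncomputable def alphaSq (i j : ℕ) : ℝ := (i:ℝ) * (2*(i:ℝ) - 1) * (2*(j:ℝ) - 1) / 8

/-- Dual function of type I on the square. -/
noncomputable def bSqI (k l : ℕ) (p : ℝ × ℝ) : ℝ × ℝ :=
  (-(1/2) : ℝ) • (alphaSq l k • btSqI k l p + alphaSq k l • btSqII k l p)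

/-- Dual function of type II on the square. -/
noncomputable def bSqII (k l : ℕ) (p : ℝ × ℝ) : ℝ × ℝ :=
  (-(1/2) : ℝ) • (alphaSq l k • btSqI k l p - alphaSq k l • btSqII k l p)

/-- Dual function of type III on the square (first family). -/
noncomputable def bSqIII (l : ℕ) (p : ℝ × ℝ) : ℝ × ℝ :=
  (-((l:ℝ) * (2*(l:ℝ) - 1) / 8)) • btSqI 1 l p

/-- Dual function of type III on the square (second family). -/
noncomputable def cSqIII (l : ℕ) (p : ℝ × ℝ) : ℝ × ℝ :=
  ((l:ℝ) * (2*(l:ℝ) - 1) / 8) • btSqII l 1 p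

set_option linter.all false
set_option linter.unusedSimpArgs false

open Polynomial in
noncomputable def auxJ (p : ℝ[X]) : ℝ := ∫ t in (-1:ℝ)..1, p.eval t

open Polynomial in
noncomputable def auxU : ℝ[X] := X ^ 2 - 1

open Polynomial in
theorem aux_int (p : ℝ[X]) (a b : ℝ) : IntervalIntegrable (fun t => p.eval t) volume a b :=
  p.continuous.intervalIntegrable a b

open Polynomial in
theorem auxJ_add (p q : ℝ[X]) : auxJ (p + q) = auxJ p + auxJ q := by
  simp only [auxJ, eval_add]
  exact intervalIntegral.integral_add (aux_int _ _ _) (aux_int _ _ _)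

open Polynomial in
theorem auxJ_C (c : ℝ) (p : ℝ[X]) : auxJ (C c * p) = c * auxJ p := by
  simp [auxJ]

open Polynomial in
theorem aux_ftc (p : ℝ[X]) (a b : ℝ) :
    ∫ t in a..b, (derivative p).eval t = p.eval b - p.eval a :=
  intervalIntegral.integral_eq_sub_of_hasDerivAt (fun x _ => p.hasDerivAt x) (aux_int _ _ _)

open Polynomial in
theorem auxJ_ibp (p q : ℝ[X]) (h1 : q.eval 1 = 0) (h2 : q.eval (-1) = 0) :
    auxJ (derivative q * p) = - auxJ (q * derivative p) := by
  have h := aux_ftc (q * p) (-1) 1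
  rw [derivative_mul] at h
  have h3 := auxJ_add (derivative q * p) (q * derivative p)
  unfold auxJ at *
  rw [h3] at h
  simp only [eval_mul, h1, h2] at h
  simp only [eval_mul]
  linarith

open Polynomial in
theorem auxU_dvd (n m : ℕ) (h : n < m) : auxU ∣ derivative^[n] (auxU ^ m) :=
  (dvd_pow_self _ (by omega)).trans (pow_sub_dvd_iterate_derivative_pow auxU m n)

open Polynomial in
theorem auxU_eval (n m : ℕ) (h : n < m) : (derivative^[n] (auxU ^ m)).eval 1 = 0 ∧
    (derivative^[n] (auxU ^ m)).eval (-1) = 0 := by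
  obtain ⟨r, hr⟩ := auxU_dvd n m h
  rw [hr]
  simp [auxU]

open Polynomial in
theorem auxJ_iter (m : ℕ) (n : ℕ) (h : n ≤ m) (p : ℝ[X]) :
    auxJ (derivative^[n] (auxU ^ m) * p) = (-1) ^ n * auxJ (auxU ^ m * derivative^[n] p) := by
  induction n generalizing p with
  | zero => simp
  | succ k ih =>
    obtain ⟨e1, e2⟩ := auxU_eval k m (by omega)
    rw [Function.iterate_succ_apply', auxJ_ibp _ _ e1 e2, ih (by omega),
      Function.iterate_succ_apply]
    ring

open Polynomial in
theorem aux_deriv_const (n : ℕ) (p : ℝ[X]) (h : p.natDegree ≤ n) :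
    derivative^[n] p = C ((n.factorial : ℝ) * p.coeff n) := by
  ext k
  rw [coeff_iterate_derivative, coeff_C]
  split_ifs with hk
  · subst hk; simp [Nat.descFactorial_self]
  · rw [coeff_eq_zero_of_natDegree_lt (by omega)]; simp

open Polynomial in
theorem auxJ_core (m n : ℕ) (h : n ≤ m) (p : ℝ[X]) (hp : p.natDegree ≤ n) :
    auxJ (derivative^[n] (auxU ^ m) * p)
      = (-1) ^ n * ((n.factorial : ℝ) * p.coeff n * auxJ (auxU ^ m)) := by
  rw [auxJ_iter m n h, aux_deriv_const n p hp, mul_comm (auxU ^ m), auxJ_C]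

open Polynomial in
theorem auxJ_U (m : ℕ) : auxJ (auxU ^ m) * ((2*m+1).factorial : ℝ)
    = (-1) ^ m * 2 ^ (2*m+1) * (m.factorial : ℝ) ^ 2 := by
  induction m with
  | zero => norm_num [auxJ]
  | succ m ih =>
    have h := aux_ftc (X * auxU ^ (m+1)) (-1) 1
    have e : derivative (X * auxU ^ (m+1)) = C (2*(m:ℝ)+3) * auxU ^ (m+1)
        + C (2*(m:ℝ)+2) * auxU ^ m := by
      simp only [derivative_mul, derivative_X, derivative_pow_succ, auxU, derivative_sub,
        derivative_X_pow, derivative_one]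
      have c2 : (C 2 : ℝ[X]) = 2 := rfl
      have c3 : (C 3 : ℝ[X]) = 3 := rfl
      simp [c2, c3]
      ring
    rw [e] at h
    have h3 := auxJ_add (C (2*(m:ℝ)+3) * auxU ^ (m+1)) (C (2*(m:ℝ)+2) * auxU ^ m)
    rw [auxJ_C, auxJ_C] at h3
    rw [auxJ, h] at h3
    simp [auxU] at h3
    change 0 = (2*(m:ℝ)+3) * auxJ (auxU^(m+1)) + (2*(m:ℝ)+2) * auxJ (auxU^m) at h3
    have e2 : ((2*(m+1)+1).factorial : ℝ) = (2*m+3)*((2*m+2) * ((2*m+1).factorial : ℝ)) := by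
      rw [show 2*(m+1)+1 = (2*m+1)+1+1 by ring, Nat.factorial_succ, Nat.factorial_succ]
      push_cast; ring
    rw [e2, Nat.factorial_succ m]
    push_cast
    have : (2*(m:ℝ)+3) * auxJ (auxU^(m+1)) = -(2*(m:ℝ)+2) * auxJ (auxU^m) := by linarith
    calc _ = ((2*(m:ℝ)+3) * auxJ (auxU^(m+1))) * ((2*m+2) * ((2*m+1).factorial : ℝ)) := by ring
      _ = -(2*(m:ℝ)+2)*(2*m+2) * (auxJ (auxU^m) * ((2*m+1).factorial : ℝ)) := by rw [this]; ring
      _ = _ := by rw [ih]; ring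

open Polynomial in
theorem auxU_monic : auxU.Monic := by
  unfold auxU; monicity!

open Polynomial in
theorem auxU_natDegree : auxU.natDegree = 2 := by
  unfold auxU; compute_degree!

open Polynomial in
theorem auxUpow_deg (m : ℕ) : (auxU ^ m).natDegree = 2 * m := by
  rw [auxU_monic.natDegree_pow, auxU_natDegree, mul_comm]

open Polynomial in
theorem auxUpow_coeff (m : ℕ) : (auxU ^ m).coeff (2*m) = 1 := by
  have := (auxU_monic.pow m).coeff_natDegree
  rwa [auxUpow_deg] at this

open Polynomial in
theorem auxW_deg (n m : ℕ) : (derivative^[n] (auxU ^ m)).natDegree ≤ 2*m - n := by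
  have := natDegree_iterate_derivative (auxU ^ m) n
  rwa [auxUpow_deg] at this

/-- quotient of D^n U^(n+1) by U -/
noncomputable def auxR (n : ℕ) : Polynomial ℝ := (auxU_dvd n (n+1) (by omega)).choose

open Polynomial in
theorem auxR_spec (n : ℕ) : derivative^[n] (auxU ^ (n+1)) = auxU * auxR n :=
  (auxU_dvd n (n+1) (by omega)).choose_spec

open Polynomial in
theorem auxR_deg (n : ℕ) : (auxR n).natDegree ≤ n := by
  have h := auxW_deg n (n+1)
  rw [auxR_spec] at h
  by_cases h0 : auxR n = 0
  · simp [h0]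
  rw [auxU_monic.natDegree_mul' h0, auxU_natDegree] at h
  omega

open Polynomial in
theorem auxR_coeff (n : ℕ) : (auxR n).coeff n * ((n+2).factorial : ℝ) = ((2*n+2).factorial : ℝ) := by
  have h : (derivative^[n] (auxU ^ (n+1))).coeff (2+n) = (auxR n).coeff n := by
    rw [auxR_spec, coeff_mul_add_eq_of_natDegree_le auxU_natDegree.le (auxR_deg n)]
    have := auxUpow_coeff 1
    simp at this
    rw [this, one_mul]
  rw [← h, coeff_iterate_derivative, show 2 + n + n = 2*(n+1) by ring, auxUpow_coeff]
  have := Nat.factorial_mul_descFactorial (show n ≤ 2*(n+1) by omega)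
  rw [show 2*(n+1) - n = n+2 by omega] at this
  rw [show 2*n+2 = 2*(n+1) by ring, ← this]
  push_cast; simp; ring

open Polynomial in
theorem auxW_coeff (n : ℕ) : (derivative^[n] (auxU ^ n)).coeff n * (n.factorial : ℝ)
    = ((2*n).factorial : ℝ) := by
  rw [coeff_iterate_derivative, show n + n = 2*n by ring, auxUpow_coeff]
  have := Nat.factorial_mul_descFactorial (show n ≤ 2*n by omega)
  rw [show 2*n - n = n by omega] at this
  rw [← this]
  push_cast; simp; ring

noncomputable def auxc (n : ℕ) : ℝ := 1 / (2 ^ n * (n.factorial : ℝ))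

open Polynomial in
noncomputable def auxL (n : ℕ) : ℝ[X] := C (auxc n) * derivative^[n] (auxU ^ n)
open Polynomial in
noncomputable def auxH (n : ℕ) : ℝ[X] := C (auxc (n+1)) * derivative^[n] (auxU ^ (n+1))
open Polynomial in
noncomputable def auxP (n : ℕ) : ℝ[X] := C (auxc n) * auxR n

open Polynomial in
theorem auxL_off (n m : ℕ) (h : m < n) : auxJ (auxL n * auxL m) = 0 := by
  have hd := auxW_deg m m
  have e : auxL n * auxL m = C (auxc n) * (C (auxc m) *
    (derivative^[n] (auxU ^ n) * derivative^[m] (auxU ^ m))) := by unfold auxL; ring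
  rw [e, auxJ_C, auxJ_C, auxJ_core n n le_rfl _ (by omega),
    coeff_eq_zero_of_natDegree_lt (by omega)]
  simp

open Polynomial in
theorem auxL_orth (n m : ℕ) : auxJ (auxL n * auxL m) = if n = m then 2 / (2*(n:ℝ)+1) else 0 := by
  split_ifs with h
  · subst h
    have hd := auxW_deg n n
    have e : auxL n * auxL n = C (auxc n) * (C (auxc n) *
      (derivative^[n] (auxU ^ n) * derivative^[n] (auxU ^ n))) := by unfold auxL; ring
    rw [e, auxJ_C, auxJ_C, auxJ_core n n le_rfl _ (by omega)]
    have h1 := auxJ_U n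
    have h2 := auxW_coeff n
    rw [Nat.factorial_succ] at h1
    have f0 : (n.factorial : ℝ) ≠ 0 := by positivity
    have f1 : ((2*n).factorial : ℝ) ≠ 0 := by positivity
    have f2 : (2*(n:ℝ)+1) ≠ 0 := by positivity
    push_cast at h1
    rw [← eq_div_iff f0] at h2
    rw [← eq_div_iff (by positivity)] at h1
    rw [h1, h2]
    unfold auxc
    have s : ((-1:ℝ)^n) * (-1)^n = 1 := by rw [← mul_pow]; simp
    field_simp
    rw [pow_add, pow_mul']
    linear_combination (2 ^ n)^2 * 2 * s
  · rcases lt_or_gt_of_ne h with h | h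
    · rw [mul_comm]; exact auxL_off m n h
    · exact auxL_off n m h

open Polynomial in
theorem auxHP_off (n m : ℕ) (h : m < n) : auxJ (derivative^[n] (auxU ^ (n+1)) * auxR m) = 0 := by
  have hd := auxR_deg m
  rw [auxJ_core (n+1) n (by omega) _ (by omega),
    coeff_eq_zero_of_natDegree_lt (by omega)]
  simp

open Polynomial in
theorem auxHP_orth (n m : ℕ) : auxJ (auxH n * auxP m) =
    if n = m then -4 / (((n:ℝ)+2)*(2*(n:ℝ)+3)) else 0 := by
  have e : auxH n * auxP m = C (auxc (n+1)) * (C (auxc m) *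
      (derivative^[n] (auxU ^ (n+1)) * auxR m)) := by unfold auxH auxP; ring
  rw [e, auxJ_C, auxJ_C]
  split_ifs with h
  · subst h
    rw [auxJ_core (n+1) n (by omega) _ (auxR_deg n)]
    have h1 := auxJ_U (n+1)
    have h2 := auxR_coeff n
    rw [show 2*(n+1)+1 = 2*n+2+1 by ring, Nat.factorial_succ (2*n+2)] at h1
    rw [Nat.factorial_succ (n+1)] at h2
    have f0 : (n.factorial : ℝ) ≠ 0 := by positivity
    have f0' : ((n+1).factorial : ℝ) ≠ 0 := by positivity
    have f1 : ((2*n+2).factorial : ℝ) ≠ 0 := by positivity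
    push_cast at h1 h2
    rw [← eq_div_iff (by positivity)] at h2
    rw [← eq_div_iff (by positivity)] at h1
    rw [h1, h2]
    unfold auxc
    have s : ((-1:ℝ)^n) * (-1)^n = 1 := by rw [← mul_pow]; simp
    have g1 : (n:ℝ)+1+1 ≠ 0 := by positivity
    have g2 : (n:ℝ)+2 ≠ 0 := by positivity
    have g3 : 2*(n:ℝ)+2+1 ≠ 0 := by positivity
    have g4 : 2*(n:ℝ)+3 ≠ 0 := by positivity
    rw [show 2*n+2+1 = n + n + 3 by ring, pow_succ (-1:ℝ) n, pow_succ (2:ℝ) n, pow_add, pow_add]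
    field_simp
    ring_nf
    ring_nf at s
    simp only [s]
    ring
  · rcases lt_or_gt_of_ne h with h | h
    · have : derivative^[n] (auxU ^ (n+1)) * auxR m = derivative^[m] (auxU ^ (m+1)) * auxR n := by
        rw [auxR_spec, auxR_spec]; ring
      rw [this, auxHP_off m n h]; simp
    · rw [auxHP_off n m h]; simp

open Polynomial in
theorem aux_iter (p : ℝ[X]) (n : ℕ) :
    iteratedDeriv n (fun t => p.eval t) = fun t => (derivative^[n] p).eval t := by
  induction n with
  | zero => simp
  | succ n ih =>
    rw [iteratedDeriv_succ, ih, Function.iterate_succ_apply']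
    ext x
    exact (Polynomial.deriv _)

open Polynomial in
theorem legendreP_eq (n : ℕ) (x : ℝ) : legendreP n x = (auxL n).eval x := by
  have : (fun t : ℝ => (1 - t)^0 * (1 + t)^0 * (t^2 - 1)^n) = fun t => (auxU ^ n).eval t := by
    ext t; simp [auxU]
  unfold legendreP jacobiP
  rw [this, aux_iter]
  simp [auxL, auxc]

open Polynomial in
theorem intLegendreP_eq (n : ℕ) (x : ℝ) : intLegendreP (n+2) x = (auxH n).eval x := by
  have e : ∀ t, jacobiP (n+2-1) 0 0 t = (derivative (auxH n)).eval t := by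
    intro t
    have := legendreP_eq (n+1) t
    rw [legendreP] at this
    rw [show n+2-1 = n+1 by omega, this, auxL, auxH, derivative_C_mul,
      Function.iterate_succ_apply']
  unfold intLegendreP intJacobiP
  simp only [e]
  rw [aux_ftc]
  have : (auxH n).eval (-1) = 0 := by
    rw [auxH, eval_mul, (auxU_eval n (n+1) (by omega)).2, mul_zero]
  rw [this, sub_zero]

open Polynomial in
theorem jacobiP_eq (n : ℕ) (x : ℝ) (hx : x ∈ Set.Ioo (-1:ℝ) 1) :
    jacobiP n 1 1 x = (auxP n).eval x := by
  have : (fun t : ℝ => (1 - t)^1 * (1 + t)^1 * (t^2 - 1)^n)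
      = fun t => (C (-1) * auxU ^ (n+1)).eval t := by
    ext t; simp [auxU]; ring
  unfold jacobiP
  rw [this, aux_iter]
  have h1 : 1 - x ≠ 0 := by linarith [hx.2]
  have h2 : 1 + x ≠ 0 := by linarith [hx.1]
  simp only [iterate_derivative_C_mul, auxR_spec, auxP, auxc, eval_mul, eval_C]
  have : eval x auxU = - ((1-x)*(1+x)) := by simp [auxU]; ring
  rw [this]
  field_simp

open Polynomial in
theorem aux_prod (a b : ℝ) (A B E F : ℝ[X]) :
    ∫ p in Sq, (a * (A.eval p.1 * B.eval p.2) + b * (E.eval p.1 * F.eval p.2))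
      = a * (auxJ A * auxJ B) + b * (auxJ E * auxJ F) := by
  have key : ∀ A B : ℝ[X], ∫ p in Sq, (A.eval p.1 * B.eval p.2) = auxJ A * auxJ B := by
    intro A B
    unfold Sq auxJ
    rw [Measure.volume_eq_prod, setIntegral_prod_mul (fun x => A.eval x) (fun x => B.eval x),
      intervalIntegral.integral_of_le (by norm_num), intervalIntegral.integral_of_le (by norm_num),
      integral_Ioc_eq_integral_Ioo, integral_Ioc_eq_integral_Ioo]
  have hint : ∀ A B : ℝ[X], IntegrableOn (fun p : ℝ × ℝ => A.eval p.1 * B.eval p.2) Sq := by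
    intro A B
    have hc : Continuous (fun p : ℝ × ℝ => A.eval p.1 * B.eval p.2) :=
      (A.continuous.comp continuous_fst).mul (B.continuous.comp continuous_snd)
    refine (hc.continuousOn.integrableOn_compact
      (isCompact_Icc.prod isCompact_Icc : IsCompact (Set.Icc (-1:ℝ) 1 ×ˢ Set.Icc (-1:ℝ) 1))).mono_set ?_
    exact Set.prod_mono Set.Ioo_subset_Icc_self Set.Ioo_subset_Icc_self
  rw [integral_add ((hint A B).const_mul a) ((hint E F).const_mul b), integral_const_mul,
    integral_const_mul, key, key]

open Polynomial in
/-- generic evaluation -/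
theorem aux_main (f : ℝ × ℝ → ℝ) (a b : ℝ) (i j k l i' j' k' l' : ℕ)
    (hf : ∀ p ∈ Sq, f p = a * ((auxL i * auxL k).eval p.1 * (auxH j * auxP l).eval p.2)
      + b * ((auxH i' * auxP k').eval p.1 * (auxL j' * auxL l').eval p.2)) :
    ∫ p in Sq, f p = a * ((if i = k then 2 / (2*(i:ℝ)+1) else 0) *
        (if j = l then -4 / (((j:ℝ)+2)*(2*(j:ℝ)+3)) else 0))
      + b * ((if i' = k' then -4 / (((i':ℝ)+2)*(2*(i':ℝ)+3)) else 0) *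
        (if j' = l' then 2 / (2*(j':ℝ)+1) else 0)) := by
  have hm : MeasurableSet Sq := measurableSet_Ioo.prod measurableSet_Ioo
  rw [setIntegral_congr_fun hm hf, aux_prod, auxL_orth, auxL_orth, auxHP_orth, auxHP_orth]

theorem aux_one (x : ℝ) : (auxL 0).eval x = 1 := by
  simp [auxL, auxc]

/-- Full biorthonormality of the `H(curl)` shape functions on the square and
their dual functions. -/
theorem square_Hcurl_biorthonormal (i j k l : ℕ) (hi : 2 ≤ i) (hj : 2 ≤ j)
    (hk : 2 ≤ k) (hl : 2 ≤ l) :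
    (∫ p in Sq, dot2 (vSqI i j p) (bSqI k l p) = if (i, j) = (k, l) then 1 else 0) ∧
    (∫ p in Sq, dot2 (vSqI i j p) (bSqII k l p) = 0) ∧
    (∫ p in Sq, dot2 (vSqI i j p) (bSqIII l p) = 0) ∧
    (∫ p in Sq, dot2 (vSqI i j p) (cSqIII l p) = 0) ∧
    (∫ p in Sq, dot2 (vSqII i j p) (bSqI k l p) = 0) ∧
    (∫ p in Sq, dot2 (vSqII i j p) (bSqII k l p) = if (i, j) = (k, l) then 1 else 0) ∧
    (∫ p in Sq, dot2 (vSqII i j p) (bSqIII l p) = 0) ∧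
    (∫ p in Sq, dot2 (vSqII i j p) (cSqIII l p) = 0) ∧
    (∫ p in Sq, dot2 (vSqIII i p) (bSqI k l p) = 0) ∧
    (∫ p in Sq, dot2 (vSqIII i p) (bSqII k l p) = 0) ∧
    (∫ p in Sq, dot2 (vSqIII i p) (bSqIII l p) = if i = l then 1 else 0) ∧
    (∫ p in Sq, dot2 (vSqIII i p) (cSqIII l p) = 0) ∧
    (∫ p in Sq, dot2 (wSqIII i p) (bSqI k l p) = 0) ∧
    (∫ p in Sq, dot2 (wSqIII i p) (bSqII k l p) = 0) ∧
    (∫ p in Sq, dot2 (wSqIII i p) (bSqIII l p) = 0) ∧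
    (∫ p in Sq, dot2 (wSqIII i p) (cSqIII l p) = if i = l then 1 else 0) := by
  obtain ⟨i, rfl⟩ := Nat.exists_eq_add_of_le' hi
  obtain ⟨j, rfl⟩ := Nat.exists_eq_add_of_le' hj
  obtain ⟨k, rfl⟩ := Nat.exists_eq_add_of_le' hk
  obtain ⟨l, rfl⟩ := Nat.exists_eq_add_of_le' hl
  have s1 : ∀ n : ℕ, n + 2 - 1 = n + 1 := fun n => by omega
  have s2 : ∀ n : ℕ, n + 2 - 2 = n := fun n => by omega
  have hj1 : ∀ p ∈ Sq, ∀ n, jacobiP n 1 1 p.1 = (auxP n).eval p.1 :=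
    fun p hp n => jacobiP_eq n _ hp.1
  have hj2 : ∀ p ∈ Sq, ∀ n, jacobiP n 1 1 p.2 = (auxP n).eval p.2 :=
    fun p hp n => jacobiP_eq n _ hp.2
  have q1 : ∀ n : ℕ, (n:ℝ) + 2 ≠ 0 := fun n => by positivity
  have q2 : ∀ n : ℕ, 2*(n:ℝ) + 3 ≠ 0 := fun n => by positivity
  have q3 : ∀ n : ℕ, 2*((n:ℝ)+1) + 1 ≠ 0 := fun n => by positivity
  refine ⟨?_, ?_, ?_, ?_, ?_, ?_, ?_, ?_, ?_, ?_, ?_, ?_, ?_, ?_, ?_, ?_⟩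
  · rw [aux_main _ (1 * (-(1/2) * alphaSq (l+2) (k+2))) (1 * (-(1/2) * alphaSq (k+2) (l+2))) (i+1) j (k+1) l i (j+1) k (l+1) (fun p hp => by 
        simp [dot2, vSqI, vSqII, vSqIII, wSqIII, bSqI, bSqII, bSqIII, cSqIII, vtSqI, vtSqII,
          btSqI, btSqII, legendreP_eq, intLegendreP_eq, hj1 p hp, hj2 p hp, aux_one]
        try ring)]
    by_cases h1 : i = k <;> by_cases h2 : j = l
    all_goals simp [h1, h2, alphaSq]
    all_goals (field_simp; ring)
  · rw [aux_main _ (1 * (-(1/2) * alphaSq (l+2) (k+2))) (1 * (1/2 * alphaSq (k+2) (l+2))) (i+1) j (k+1) l i (j+1) k (l+1) (fun p hp => by 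
        simp [dot2, vSqI, vSqII, vSqIII, wSqIII, bSqI, bSqII, bSqIII, cSqIII, vtSqI, vtSqII,
          btSqI, btSqII, legendreP_eq, intLegendreP_eq, hj1 p hp, hj2 p hp, aux_one]
        try ring)]
    by_cases h1 : i = k <;> by_cases h2 : j = l
    all_goals simp [h1, h2, alphaSq]
    all_goals (field_simp; ring)
  · rw [aux_main _ (1 * (-(((l:ℝ)+2) * (2*((l:ℝ)+2) - 1) / 8))) 0 (i+1) j 0 l i (j+1) 0 0 (fun p hp => by 
        simp [dot2, vSqI, vSqII, vSqIII, wSqIII, bSqI, bSqII, bSqIII, cSqIII, vtSqI, vtSqII,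
          btSqI, btSqII, legendreP_eq, intLegendreP_eq, hj1 p hp, hj2 p hp, aux_one]
        try ring)]
    by_cases h1 : i = k <;> by_cases h2 : j = l
    all_goals simp [h1, h2, alphaSq]
    all_goals (field_simp; ring)
  · rw [aux_main _ 0 (1 * (((l:ℝ)+2) * (2*((l:ℝ)+2) - 1) / 8)) (i+1) j 0 0 i (j+1) l 0 (fun p hp => by 
        simp [dot2, vSqI, vSqII, vSqIII, wSqIII, bSqI, bSqII, bSqIII, cSqIII, vtSqI, vtSqII,
          btSqI, btSqII, legendreP_eq, intLegendreP_eq, hj1 p hp, hj2 p hp, aux_one]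
        try ring)]
    by_cases h1 : i = k <;> by_cases h2 : j = l
    all_goals simp [h1, h2, alphaSq]
    all_goals (field_simp; ring)
  · rw [aux_main _ (1 * (-(1/2) * alphaSq (l+2) (k+2))) ((-1) * (-(1/2) * alphaSq (k+2) (l+2))) (i+1) j (k+1) l i (j+1) k (l+1) (fun p hp => by 
        simp [dot2, vSqI, vSqII, vSqIII, wSqIII, bSqI, bSqII, bSqIII, cSqIII, vtSqI, vtSqII,
          btSqI, btSqII, legendreP_eq, intLegendreP_eq, hj1 p hp, hj2 p hp, aux_one]
        try ring)]
    by_cases h1 : i = k <;> by_cases h2 : j = l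
    all_goals simp [h1, h2, alphaSq]
    all_goals (field_simp; ring)
  · rw [aux_main _ (1 * (-(1/2) * alphaSq (l+2) (k+2))) ((-1) * (1/2 * alphaSq (k+2) (l+2))) (i+1) j (k+1) l i (j+1) k (l+1) (fun p hp => by 
        simp [dot2, vSqI, vSqII, vSqIII, wSqIII, bSqI, bSqII, bSqIII, cSqIII, vtSqI, vtSqII,
          btSqI, btSqII, legendreP_eq, intLegendreP_eq, hj1 p hp, hj2 p hp, aux_one]
        try ring)]
    by_cases h1 : i = k <;> by_cases h2 : j = l
    all_goals simp [h1, h2, alphaSq]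
    all_goals (field_simp; ring)
  · rw [aux_main _ (1 * (-(((l:ℝ)+2) * (2*((l:ℝ)+2) - 1) / 8))) 0 (i+1) j 0 l i (j+1) 0 0 (fun p hp => by 
        simp [dot2, vSqI, vSqII, vSqIII, wSqIII, bSqI, bSqII, bSqIII, cSqIII, vtSqI, vtSqII,
          btSqI, btSqII, legendreP_eq, intLegendreP_eq, hj1 p hp, hj2 p hp, aux_one]
        try ring)]
    by_cases h1 : i = k <;> by_cases h2 : j = l
    all_goals simp [h1, h2, alphaSq]
    all_goals (field_simp; ring)
  · rw [aux_main _ 0 ((-1) * (((l:ℝ)+2) * (2*((l:ℝ)+2) - 1) / 8)) (i+1) j 0 0 i (j+1) l 0 (fun p hp => by 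
        simp [dot2, vSqI, vSqII, vSqIII, wSqIII, bSqI, bSqII, bSqIII, cSqIII, vtSqI, vtSqII,
          btSqI, btSqII, legendreP_eq, intLegendreP_eq, hj1 p hp, hj2 p hp, aux_one]
        try ring)]
    by_cases h1 : i = k <;> by_cases h2 : j = l
    all_goals simp [h1, h2, alphaSq]
    all_goals (field_simp; ring)
  · rw [aux_main _ (1 * (-(1/2) * alphaSq (l+2) (k+2))) 0 0 i (k+1) l 0 0 k (l+1) (fun p hp => by 
        simp [dot2, vSqI, vSqII, vSqIII, wSqIII, bSqI, bSqII, bSqIII, cSqIII, vtSqI, vtSqII,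
          btSqI, btSqII, legendreP_eq, intLegendreP_eq, hj1 p hp, hj2 p hp, aux_one]
        try ring)]
    by_cases h0 : i = l
    all_goals simp [h0, alphaSq]
    all_goals (field_simp; ring)
  · rw [aux_main _ (1 * (-(1/2) * alphaSq (l+2) (k+2))) 0 0 i (k+1) l 0 0 k (l+1) (fun p hp => by 
        simp [dot2, vSqI, vSqII, vSqIII, wSqIII, bSqI, bSqII, bSqIII, cSqIII, vtSqI, vtSqII,
          btSqI, btSqII, legendreP_eq, intLegendreP_eq, hj1 p hp, hj2 p hp, aux_one]
        try ring)]
    by_cases h0 : i = l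
    all_goals simp [h0, alphaSq]
    all_goals (field_simp; ring)
  · rw [aux_main _ (1 * (-(((l:ℝ)+2) * (2*((l:ℝ)+2) - 1) / 8))) 0 0 i 0 l 0 0 0 0 (fun p hp => by 
        simp [dot2, vSqI, vSqII, vSqIII, wSqIII, bSqI, bSqII, bSqIII, cSqIII, vtSqI, vtSqII,
          btSqI, btSqII, legendreP_eq, intLegendreP_eq, hj1 p hp, hj2 p hp, aux_one]
        try ring)]
    by_cases h0 : i = l
    all_goals simp [h0, alphaSq]
    all_goals (field_simp; ring)
  · rw [aux_main _ 0 0 0 i 0 0 0 0 l 0 (fun p hp => by 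
        simp [dot2, vSqI, vSqII, vSqIII, wSqIII, bSqI, bSqII, bSqIII, cSqIII, vtSqI, vtSqII,
          btSqI, btSqII, legendreP_eq, intLegendreP_eq, hj1 p hp, hj2 p hp, aux_one]
        try ring)]
    by_cases h0 : i = l
    all_goals simp [h0, alphaSq]
    all_goals (field_simp; ring)
  · rw [aux_main _ 0 ((-1) * (-(1/2) * alphaSq (k+2) (l+2))) 0 0 (k+1) l i 0 k (l+1) (fun p hp => by 
        simp [dot2, vSqI, vSqII, vSqIII, wSqIII, bSqI, bSqII, bSqIII, cSqIII, vtSqI, vtSqII,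
          btSqI, btSqII, legendreP_eq, intLegendreP_eq, hj1 p hp, hj2 p hp, aux_one]
        try ring)]
    by_cases h0 : i = l
    all_goals simp [h0, alphaSq]
    all_goals (field_simp; ring)
  · rw [aux_main _ 0 ((-1) * (1/2 * alphaSq (k+2) (l+2))) 0 0 (k+1) l i 0 k (l+1) (fun p hp => by 
        simp [dot2, vSqI, vSqII, vSqIII, wSqIII, bSqI, bSqII, bSqIII, cSqIII, vtSqI, vtSqII,
          btSqI, btSqII, legendreP_eq, intLegendreP_eq, hj1 p hp, hj2 p hp, aux_one]
        try ring)]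
    by_cases h0 : i = l
    all_goals simp [h0, alphaSq]
    all_goals (field_simp; ring)
  · rw [aux_main _ 0 0 0 0 0 l i 0 0 0 (fun p hp => by 
        simp [dot2, vSqI, vSqII, vSqIII, wSqIII, bSqI, bSqII, bSqIII, cSqIII, vtSqI, vtSqII,
          btSqI, btSqII, legendreP_eq, intLegendreP_eq, hj1 p hp, hj2 p hp, aux_one]
        try ring)]
    by_cases h0 : i = l
    all_goals simp [h0, alphaSq]
    all_goals (field_simp; ring)
  · rw [aux_main _ 0 ((-1) * (((l:ℝ)+2) * (2*((l:ℝ)+2) - 1) / 8)) 0 0 0 0 i 0 l 0 (fun p hp => by 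
        simp [dot2, vSqI, vSqII, vSqIII, wSqIII, bSqI, bSqII, bSqIII, cSqIII, vtSqI, vtSqII,
          btSqI, btSqII, legendreP_eq, intLegendreP_eq, hj1 p hp, hj2 p hp, aux_one]
        try ring)]
    by_cases h0 : i = l
    all_goals simp [h0, alphaSq]
    all_goals (field_simp; ring)
end
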